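/- Let A ⊂ H be a subset of a Hilbert space, let W₁,…,Wₙ ⊂ H and r₁,…,rₙ ≥ 0 be such that for each i = 1,…,n the set A is contained in the union of the closed balls of radius rᵢ centred at the points of Wᵢ. Set r = max{rᵢ + rⱼ : 1 ≤ i,j ≤ n}. Then for any θ ∈ Δₙ, A is contained in the union of the closed balls of radius max{rᵢ : 1 ≤ i ≤ n} centred at the points of [W₁,…,Wₙ]_θ^r. -/

import Mathlib

open Metric Set

noncomputable section

/-- The set `[W₁,…,Wₙ]_θ^α` of convex combinations, with weights `θ`, of tuples
`(u₁,…,uₙ)` with `uᵢ ∈ Wᵢ` and `‖uᵢ - uⱼ‖ ≤ α` for all `i, j`. -/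
def combSet {H : Type*} [NormedAddCommGroup H] [InnerProductSpace ℝ H] {n : ℕ}
    (W : Fin n → Set H) (θ : Fin n → ℝ) (α : ℝ) : Set H :=
  {x | ∃ u : Fin n → H, (∀ i, u i ∈ W i) ∧ (∀ i j, ‖u i - u j‖ ≤ α) ∧ x = ∑ i, θ i • u i}

/-- inclusion (6.17): if `A` is covered, for each `i`, by the closed balls of
radius `rᵢ` centred at the points of `Wᵢ`, and `r = max_{i,j} (rᵢ + rⱼ)`, then for any `θ` in the
simplex, `A` is covered by the closed balls of radius `max_i rᵢ` centred at the points of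
`[W₁,…,Wₙ]_θ^r`. -/
theorem covering_by_combSet
    {H : Type*} [NormedAddCommGroup H] [InnerProductSpace ℝ H] [CompleteSpace H]
    {n : ℕ} (hn : 0 < n) (A : Set H) (W : Fin n → Set H) (rr : Fin n → ℝ)
    (hrr : ∀ i, 0 ≤ rr i)
    (hcov : ∀ i, A ⊆ ⋃ u ∈ W i, Metric.closedBall u (rr i))
    (θ : Fin n → ℝ) (hθ : θ ∈ stdSimplex ℝ (Fin n)) :
    A ⊆ ⋃ u ∈ combSet W θ (⨆ i, ⨆ j, (rr i + rr j)), Metric.closedBall u (⨆ i, rr i) := by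
  intro x hx
  have h : ∀ i, ∃ u ∈ W i, dist x u ≤ rr i := fun i => by
    simpa [Metric.mem_closedBall] using hcov i hx
  choose u hu hd using h
  simp only [Set.mem_iUnion]
  refine ⟨∑ i, θ i • u i, ⟨u, hu, fun i j => ?_, rfl⟩, ?_⟩
  · have h1 : ‖u i - u j‖ ≤ rr i + rr j := by
      rw [← dist_eq_norm]
      have := dist_triangle_left (u i) (u j) x
      linarith [hd i, hd j]
    have h2 : rr i + rr j ≤ ⨆ j, (rr i + rr j) :=
      le_ciSup (f := fun j => rr i + rr j) (Set.finite_range _).bddAbove j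
    have h3 : (⨆ j, (rr i + rr j)) ≤ ⨆ i, ⨆ j, (rr i + rr j) :=
      le_ciSup (f := fun i => ⨆ j, (rr i + rr j)) (Set.finite_range _).bddAbove i
    exact h1.trans (h2.trans h3)
  · rw [Metric.mem_closedBall_comm]
    refine (convex_closedBall x (⨆ i, rr i)).sum_mem (fun i _ => hθ.1 i) hθ.2 fun i _ => ?_
    rw [Metric.mem_closedBall_comm, Metric.mem_closedBall]
    exact (hd i).trans (le_ciSup (Set.finite_range rr).bddAbove i)

end
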